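/- arXiv:0912.1414 — 3 statements merged into one kernel-verified Lean document; each statement's English description precedes it below -/
import Mathlib

section
/- Stickelberger's congruence, valuation form: for every integer a with 1 ≤ a ≤ N−1, the 𝔅-adic valuation of the Gauss sum G(χ^{−a}) equals S(an), i.e. v_𝔅(G(χ^{−a})) = S(an). -/
open NumberField

/-- The digit sum `S(a) = c₀ + ⋯ + c_{f−1}` of the base-`p` expansion of `a`. -/
def digitSum (p a : ℕ) : ℕ := (Nat.digits p a).sum

namespace FiniteField

variable {F : Type*} [Field F] [Fintype F]

theorem sum_inv_eq_zero (hF : 2 < Fintype.card F) : ∑ x : F, x⁻¹ = 0 := by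
  rw [Fintype.sum_equiv (Equiv.inv F) (fun x : F => x⁻¹) (fun x => x) fun _ => rfl]
  simpa using sum_pow_lt_card_sub_one F 1 (by omega)

theorem sum_inv_mul_one_sub_inv_pow {b : ℕ} (hb : b ≠ 0) (hbF : b < Fintype.card F - 1) :
    ∑ x : F, x⁻¹ * (1 - x)⁻¹ ^ b = -((b + 1 : ℕ) : F) := by
  classical
  have hsub : ∑ x : F, x⁻¹ * (1 - x)⁻¹ ^ b = ∑ y : F, (1 - y⁻¹)⁻¹ * y ^ b := by
    rw [← (Equiv.subLeft (1 : F)).sum_comp]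
    exact Fintype.sum_equiv (Equiv.inv F) _ _ fun y => by simp
  have hterm (y : F) : (1 - y⁻¹)⁻¹ * y ^ b =
      ∑ i ∈ Finset.range (b + 1), y ^ i + (y - 1)⁻¹ - if y = 1 then ((b + 1 : ℕ) : F) else 0 := by
    rcases eq_or_ne y 0 with rfl | hy
    · simp [hb, Finset.sum_range_succ']
    rcases eq_or_ne y 1 with rfl | hy1
    · simp
    have h1 : y - 1 ≠ 0 := sub_ne_zero.2 hy1
    have h2 : 1 - y⁻¹ = (y - 1) * y⁻¹ := by field_simp
    rw [if_neg hy1, geom_sum_eq hy1, h2]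
    field_simp
    ring
  simp_rw [hsub, hterm]
  rw [Finset.sum_sub_distrib, Finset.sum_add_distrib, Finset.sum_comm,
    Finset.sum_eq_zero fun i hi => sum_pow_lt_card_sub_one F i (by grind),
    Fintype.sum_equiv (Equiv.subRight (1 : F)) (fun x : F => (x - 1)⁻¹) _ fun _ => rfl,
    sum_inv_eq_zero (by omega)]
  simp

theorem sum_inv_mul_trace (K : Type*) [Field K] [Algebra K F] :
    ∑ x : F, x⁻¹ * algebraMap K F (Algebra.trace K F x) = -1 := by
  have : Finite K := Finite.of_injective _ (algebraMap K F).injective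
  have hcard := Module.natCard_eq_pow_finrank (K := K) (V := F)
  have hK : 1 < Nat.card K := Finite.one_lt_card
  obtain ⟨d, hd⟩ : ∃ d, Module.finrank K F = d + 1 :=
    ⟨_, (Nat.succ_pred_eq_of_pos Module.finrank_pos).symm⟩
  have hone : ∑ x : F, x⁻¹ * x = -1 := by
    classical
    have : ∀ x : F, x⁻¹ * x = 1 - if x = 0 then 1 else 0 := by
      intro x
      by_cases hx : x = 0 <;> simp [hx]
    simp [this]
  simp_rw [algebraMap_trace_eq_sum_pow, Finset.mul_sum]
  rw [Finset.sum_comm, hd, Finset.sum_range_succ', pow_zero, Finset.sum_eq_zero, zero_add]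
  · simpa using hone
  · intro i hi
    have hlt : Nat.card K ^ (i + 1) < Fintype.card F := by
      rw [← Nat.card_eq_fintype_card, hcard, hd]
      exact Nat.pow_lt_pow_right hK (by grind)
    have hgt : 1 < Nat.card K ^ (i + 1) := Nat.one_lt_pow (by omega) hK
    rw [← sum_pow_lt_card_sub_one F (Nat.card K ^ (i + 1) - 1) (by omega)]
    refine Finset.sum_congr rfl fun x _ => ?_
    rcases eq_or_ne x 0 with rfl | hx
    · simp [Nat.sub_ne_zero_of_lt hgt]
    · rw [pow_sub₀ _ hx hgt.le, pow_one, mul_comm]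

theorem trace_pow_char (p : ℕ) [Fact p.Prime] [Algebra (ZMod p) F] (x : F) :
    Algebra.trace (ZMod p) F (x ^ p) = Algebra.trace (ZMod p) F x := by
  have := Algebra.trace_eq_of_algEquiv (frobeniusAlgEquivOfAlgebraic (ZMod p) F) x
  simpa using this

end FiniteField

namespace IsPrimitiveRoot

open Polynomial in
theorem prime_mem_pow_of_sub_one_mem {R : Type*} [CommRing R] [IsDomain R] {p : ℕ}
    (hp : p.Prime) {ζ : R} (hζ : IsPrimitiveRoot ζ p) {I : Ideal R} (hI : ζ - 1 ∈ I) :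
    (p : R) ∈ I ^ (p - 1) := by
  have : Fact p.Prime := ⟨hp⟩
  rw [← eval_one_cyclotomic_prime (R := R) (p := p),
    cyclotomic_eq_prod_X_sub_primitiveRoots hζ, eval_prod, ← Nat.totient_prime hp,
    ← hζ.card_primitiveRoots, ← Finset.prod_const]
  refine Ideal.prod_mem_prod fun η hη => ?_
  obtain ⟨i, -, rfl⟩ := hζ.eq_pow_of_pow_eq_one (isPrimitiveRoot_of_mem_primitiveRoots hη).pow_eq_one
  simpa using I.neg_mem (I.mem_of_dvd (sub_one_dvd_pow_sub_one ζ i) hI)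

theorem isCyclotomicExtension_mul_of_adjoin_eq_top {K L : Type*} [Field K] [Field L] [Algebra K L]
    {m n : ℕ} [NeZero m] [NeZero n] (hmn : m.Coprime n) {ζ η : L} (hζ : IsPrimitiveRoot ζ m)
    (hη : IsPrimitiveRoot η n) (h : Algebra.adjoin K {ζ, η} = ⊤) :
    IsCyclotomicExtension {m * n} K L := by
  rw [IsCyclotomicExtension.iff_singleton]
  refine ⟨⟨ζ * η, ?_⟩, fun x => ?_⟩
  · rw [hζ.eq_orderOf, hη.eq_orderOf] at hmn ⊢
    rw [← (Commute.all ζ η).orderOf_mul_eq_mul_orderOf_of_coprime hmn]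
    exact IsPrimitiveRoot.orderOf _
  · refine Algebra.adjoin_mono ?_ (h ▸ Algebra.mem_top : x ∈ Algebra.adjoin K {ζ, η})
    rintro y (rfl | rfl)
    · simp [pow_mul, hζ.pow_eq_one]
    · simp [mul_comm m, pow_mul, hη.pow_eq_one]

end IsPrimitiveRoot

theorem IsPrimitiveRoot.sub_one_notMem_sq {p m : ℕ} (hp : p.Prime) (hpm : p.Coprime m)
    {K : Type*} [Field K] [NumberField K] [NeZero m] [IsCyclotomicExtension {p * m} ℚ K]
    {ζ : 𝓞 K} (hζ : IsPrimitiveRoot ζ p) (P : Ideal (𝓞 K)) [P.IsPrime] (hpP : (p : 𝓞 K) ∈ P) :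
    ζ - 1 ∉ P ^ 2 := by
  have : Fact p.Prime := ⟨hp⟩
  have hlies : P.LiesOver (Ideal.span {(p : ℤ)}) := by
    rw [Ideal.liesOver_iff]
    refine Ideal.IsMaximal.eq_of_le (Int.ideal_span_isMaximal_of_prime p) Ideal.IsPrime.ne_top' ?_
    simpa [Ideal.span_singleton_le_iff_mem, Ideal.under]
  have hmap : Ideal.map (algebraMap ℤ (𝓞 K)) (Ideal.span {(p : ℤ)}) = Ideal.span {(p : 𝓞 K)} := by
    simp [Ideal.map_span]
  have hne : Ideal.span {(p : 𝓞 K)} ≠ ⊥ := by simp [hp.ne_zero]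
  have hram := IsCyclotomicExtension.Rat.ramificationIdx_eq (p := p) (k := 0) (m := m) (p * m) K P
    (by simp) ((Nat.Prime.coprime_iff_not_dvd hp).1 hpm)
  rw [Ideal.IsDedekindDomain.ramificationIdx_eq_multiplicity (Ideal.span {(p : ℤ)}) _ (hmap ▸ hne),
    hmap] at hram
  intro hmem
  have hdvd : P ^ p ∣ Ideal.span {(p : 𝓞 K)} := by
    rw [Ideal.dvd_span_singleton]
    have := hζ.prime_mem_pow_of_sub_one_mem hp hmem
    rw [← pow_mul] at this
    exact Ideal.pow_le_pow_right (by have := hp.two_le; omega) this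
  have hP : P ≠ ⊥ := by
    rintro rfl
    simp [hp.ne_zero] at hpP
  have hfin : FiniteMultiplicity P (Ideal.span {(p : 𝓞 K)}) :=
    FiniteMultiplicity.of_prime_left (Ideal.prime_of_isPrime hP inferInstance) hne
  have := hfin.le_multiplicity_of_pow_dvd hdvd
  have := hp.two_le
  simp at hram
  omega

section Residue

variable {R F : Type*} [CommRing R] [Field F] (red : R →+* F)

theorem RingHom.map_eq_one_of_pow_char_eq_one (p : ℕ) [Fact p.Prime] [CharP F p] {ζ : R}
    (hζ : ζ ^ p = 1) : red ζ = 1 :=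
  frobenius_inj F p <| by simp [frobenius_def, ← map_pow, hζ]

theorem eq_of_pow_eq_one_of_map_eq [IsDomain R] {m : ℕ} (hm : (m : F) ≠ 0) {u w : R}
    (hu : u ^ m = 1) (hw : w ^ m = 1) (h : red u = red w) : u = w := by
  have hm0 : m ≠ 0 := by rintro rfl; simp at hm
  have hmul := (Commute.all u w).geom_sum₂_mul m
  rw [hu, hw, sub_self, mul_eq_zero] at hmul
  refine sub_eq_zero.1 (hmul.resolve_left fun h0 => ?_)
  have hw0 : red w ≠ 0 := fun h0 => by
    have := congrArg red hw
    simp [h0, hm0] at this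
  have := congrArg red h0
  simp only [map_sum, map_mul, map_pow, h, map_zero] at this
  rw [geom_sum₂_self] at this
  exact mul_ne_zero hm (pow_ne_zero _ hw0) this

variable [IsDedekindDomain R]

theorem emultiplicity_span_eq_zero_of_map_ne_zero {x : R} (hx : red x ≠ 0) :
    emultiplicity (RingHom.ker red) (Ideal.span {x}) = 0 := by
  rwa [emultiplicity_eq_zero, Ideal.dvd_span_singleton, RingHom.mem_ker]

theorem Ideal.emultiplicity_span_mul {P : Ideal R} (hP : Prime P) (x y : R) :
    emultiplicity P (Ideal.span {x * y}) =
      emultiplicity P (Ideal.span {x}) + emultiplicity P (Ideal.span {y}) := by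
  rw [← Ideal.span_singleton_mul_span_singleton, emultiplicity_mul hP]

end Residue

section GaussSum

open FiniteField

variable {R F : Type*} [CommRing R] [Field F] {p : ℕ} [Fact p.Prime]
  [Algebra (ZMod p) F]

/-- The additive character `x ↦ ζ ^ Tr x` of a finite field of characteristic `p`, for `ζ` a
`p`-th root of unity. -/
noncomputable def AddChar.ofTrace (F : Type*) [Field F] [Algebra (ZMod p) F] {ζ : R}
    (hζ : ζ ^ p = 1) : AddChar F R :=
  (AddChar.zmodChar p hζ).compAddMonoidHom (Algebra.trace (ZMod p) F).toAddMonoidHom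

theorem AddChar.ofTrace_apply {ζ : R} (hζ : ζ ^ p = 1) (x : F) :
    AddChar.ofTrace F hζ x = ζ ^ (Algebra.trace (ZMod p) F x).val :=
  rfl

variable [Fintype F]

theorem gaussSum_pow_char {ζ : R} (hζ : ζ ^ p = 1) (θ : MulChar F R) :
    gaussSum (θ ^ p) (AddChar.ofTrace F hζ) = gaussSum θ (AddChar.ofTrace F hζ) := by
  have : CharP F p := charP_of_injective_algebraMap (algebraMap (ZMod p) F).injective p
  refine Fintype.sum_equiv (frobeniusEquiv F p).toEquiv _ _ fun x => ?_
  simp [MulChar.pow_apply' _ (NeZero.ne p), AddChar.ofTrace_apply, trace_pow_char, frobenius_def]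

variable (red : R →+* F) {θ : MulChar F R} (hθ : ∀ x, red (θ x) = x⁻¹)

include hθ

theorem MulChar.pow_ne_one_of_map_eq_inv {a : ℕ} (ha : a ≠ 0) (haF : a < Fintype.card F - 1) :
    θ ^ a ≠ 1 := fun h => by
  refine Nat.not_dvd_of_pos_of_lt (Nat.pos_of_ne_zero ha) haF
    ((forall_pow_eq_one_iff F a).1 fun x => ?_)
  have := congrArg red (congrArg (· (x : F)) h)
  simpa [MulChar.pow_apply' _ ha, hθ, Units.ext_iff] using this

theorem map_jacobiSum_pow {b : ℕ} (hb : b ≠ 0) (hbF : b < Fintype.card F - 1) :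
    red (jacobiSum θ (θ ^ b)) = -((b + 1 : ℕ) : F) := by
  rw [← sum_inv_mul_one_sub_inv_pow hb hbF]
  simp [jacobiSum, MulChar.pow_apply' _ hb, hθ]

theorem exists_gaussSum_eq_sub_one_mul [IsDomain R] {ζ : R} (hζ : ζ ^ p = 1) (hF : 2 < Fintype.card F) :
    ∃ c, gaussSum θ (AddChar.ofTrace F hζ) = (ζ - 1) * c ∧ red c = -1 := by
  have : CharP F p := charP_of_injective_algebraMap (algebraMap (ZMod p) F).injective p
  have hθ1 : θ ≠ 1 := by
    simpa using MulChar.pow_ne_one_of_map_eq_inv red hθ one_ne_zero (by omega)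
  refine ⟨∑ x, θ x * ∑ i ∈ Finset.range (Algebra.trace (ZMod p) F x).val, ζ ^ i, ?_, ?_⟩
  · rw [← sub_zero (gaussSum _ _), ← MulChar.sum_eq_zero_of_ne_one hθ1, gaussSum,
      ← Finset.sum_sub_distrib, Finset.mul_sum]
    refine Finset.sum_congr rfl fun x _ => ?_
    rw [AddChar.ofTrace_apply, mul_left_comm, mul_geom_sum]
    ring
  · rw [← sum_inv_mul_trace (F := F) (ZMod p)]
    simp only [map_sum, map_mul, hθ, map_pow, red.map_eq_one_of_pow_char_eq_one p hζ, one_pow,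
      Finset.sum_const, Finset.card_range, nsmul_eq_mul, mul_one]
    refine Finset.sum_congr rfl fun x _ => ?_
    rw [← map_natCast (algebraMap (ZMod p) F), ZMod.natCast_zmod_val]

/-- **Stickelberger**: if `θ` is the inverse of the Teichmüller character, the valuation of the
Gauss sum of `θ ^ a` is the sum of the base-`p` digits of `a` times the valuation of `ζ - 1`. -/
theorem emultiplicity_gaussSum_pow [IsDedekindDomain R] (hker : Prime (RingHom.ker red)) {ζ : R}
    (hζ : ζ ^ p = 1) (hF : 2 < Fintype.card F) (a : ℕ) (ha : a ≠ 0)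
    (haF : a < Fintype.card F - 1) :
    emultiplicity (RingHom.ker red) (Ideal.span {gaussSum (θ ^ a) (AddChar.ofTrace F hζ)}) =
      (Nat.digits p a).sum * emultiplicity (RingHom.ker red) (Ideal.span {ζ - 1}) := by
  have hp : p.Prime := Fact.out
  have : CharP F p := charP_of_injective_algebraMap (algebraMap (ZMod p) F).injective p
  have hone : emultiplicity (RingHom.ker red) (Ideal.span {gaussSum θ (AddChar.ofTrace F hζ)}) =
      emultiplicity (RingHom.ker red) (Ideal.span {ζ - 1}) := by
    obtain ⟨c, hc, hc1⟩ := exists_gaussSum_eq_sub_one_mul red hθ hζ hF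
    rw [hc, Ideal.emultiplicity_span_mul hker,
      emultiplicity_span_eq_zero_of_map_ne_zero red (x := c) (by simp [hc1]), add_zero]
  induction a using Nat.strong_induction_on with
  | _ a ih =>
  by_cases hpa : p ∣ a
  · obtain ⟨b, rfl⟩ := hpa
    have hb : b ≠ 0 := right_ne_zero_of_mul ha
    have hlt : b < p * b := lt_mul_of_one_lt_left (Nat.pos_of_ne_zero hb) hp.one_lt
    rw [mul_comm p b, pow_mul, gaussSum_pow_char, mul_comm b p,
      Nat.digits_def' hp.one_lt (Nat.pos_of_ne_zero ha), Nat.mul_mod_right,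
      Nat.mul_div_cancel_left _ hp.pos, List.sum_cons, zero_add]
    exact ih b hlt hb (hlt.trans haF)
  · obtain ⟨b, rfl⟩ := Nat.exists_eq_succ_of_ne_zero ha
    rcases eq_or_ne b 0 with rfl | hb
    · simpa [Nat.digits_of_lt p 1 one_ne_zero hp.one_lt] using hone
    have hdigits : (Nat.digits p (b + 1)).sum = (Nat.digits p b).sum + 1 := by
      have hdiv : (b + 1) / p = b / p := Nat.succ_div_of_not_dvd hpa
      have hmod : (b + 1) % p = b % p + 1 := by
        have h1 := Nat.div_add_mod (b + 1) p
        have h2 := Nat.div_add_mod b p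
        rw [hdiv] at h1
        omega
      rw [Nat.digits_def' hp.one_lt (Nat.succ_pos b),
        Nat.digits_def' hp.one_lt (Nat.pos_of_ne_zero hb), hmod, hdiv]
      simp only [List.sum_cons]
      ring
    have hJ := jacobiSum_mul_nontrivial (χ := θ) (φ := θ ^ b)
      (by rw [← pow_succ']; exact MulChar.pow_ne_one_of_map_eq_inv red hθ ha haF)
      (AddChar.ofTrace F hζ)
    have hv := congrArg (fun x => emultiplicity (RingHom.ker red) (Ideal.span {x})) hJ
    simp only [Ideal.emultiplicity_span_mul hker] at hv
    rw [emultiplicity_span_eq_zero_of_map_ne_zero red (x := jacobiSum θ (θ ^ b)), add_zero, hone,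
      ih b (Nat.lt_succ_self b) hb (by omega), ← pow_succ'] at hv
    · rw [Nat.succ_eq_add_one, hv, hdigits]
      push_cast
      ring
    · rw [map_jacobiSum_pow red hθ hb (by omega), neg_ne_zero, Ne, CharP.cast_eq_zero_iff F p]
      exact hpa

end GaussSum

/-- **Stickelberger's congruence, valuation form.**
Let `p` be an odd prime, `N ≥ 2` with `gcd(N,p) = 1`, `f` the order of `p` mod `N`,
`q = p^f`, `n = (q−1)/N`.  Let `E = ℚ(ζ_{q−1}, ζ_p)` (a number field generated over `ℚ`
by a primitive `(q−1)`-st root of unity `ζ` and a primitive `p`-th root of unity `ζp`),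
and let `𝔅` be the prime ideal of `𝓞 E` above `p` (with residue field `F_q`).
Let `ω` be the Teichmüller map: the inverse of the reduction bijection from the
`(q−1)`-st roots of unity onto the nonzero residues (with `ω 0 = 0`), and let
`χ = ω^n` be the associated multiplicative character of order `N`.
Then for `1 ≤ a ≤ N − 1` the `𝔅`-adic valuation of the Gauss sum
`G(χ^{−a}) = ∑_{x ≠ 0} ω(x)^{(N−a)n} ζp^{T(x)}` equals `S(an)`; that is,
`G(χ^{−a}) ∈ 𝔅^{S(an)}` and `G(χ^{−a}) ∉ 𝔅^{S(an)+1}`. -/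
theorem stickelberger_congruence_valuation
    (p N f q n : ℕ) (hp : p.Prime) (hodd : Odd p)
    (hN : 2 ≤ N) (hNp : Nat.Coprime N p)
    (hf : orderOf (p : ZMod N) = f) (hq : q = p ^ f) (hn : n = (q - 1) / N)
    (E : Type) [Field E] [NumberField E]
    (ζ ζp : 𝓞 E)
    (hζ : IsPrimitiveRoot ζ (q - 1)) (hζp : IsPrimitiveRoot ζp p)
    (hgen : Algebra.adjoin ℚ {(ζ : E), (ζp : E)} = ⊤)
    (𝔅 : Ideal (𝓞 E)) (hprime : 𝔅.IsPrime) (hp𝔅 : (p : 𝓞 E) ∈ 𝔅)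
    [Fintype (𝓞 E ⧸ 𝔅)] [DecidableEq (𝓞 E ⧸ 𝔅)]
    (hcard : Fintype.card (𝓞 E ⧸ 𝔅) = q)
    [Algebra (ZMod p) (𝓞 E ⧸ 𝔅)]
    (ω : (𝓞 E ⧸ 𝔅) → 𝓞 E)
    (hω0 : ω 0 = 0)
    (hωroot : ∀ t : 𝓞 E ⧸ 𝔅, t ≠ 0 → ω t ^ (q - 1) = 1)
    (hωlift : ∀ t : 𝓞 E ⧸ 𝔅, Ideal.Quotient.mk 𝔅 (ω t) = t) :
    ∀ a : ℕ, 1 ≤ a → a ≤ N - 1 →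
      (∑ x ∈ Finset.univ.filter (fun x : 𝓞 E ⧸ 𝔅 => x ≠ 0),
          ω x ^ ((N - a) * n) * ζp ^ (Algebra.trace (ZMod p) (𝓞 E ⧸ 𝔅) x).val)
        ∈ 𝔅 ^ digitSum p (a * n) ∧
      (∑ x ∈ Finset.univ.filter (fun x : 𝓞 E ⧸ 𝔅 => x ≠ 0),
          ω x ^ ((N - a) * n) * ζp ^ (Algebra.trace (ZMod p) (𝓞 E ⧸ 𝔅) x).val)
        ∉ 𝔅 ^ (digitSum p (a * n) + 1) := by
  intro a ha haN
  have : Fact p.Prime := ⟨hp⟩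
  have : NeZero N := ⟨by omega⟩
  have hpN : (p : ZMod N) ^ f = 1 := hf ▸ pow_orderOf_eq_one _
  have hf0 : f ≠ 0 := by
    rw [← hf, Ne, orderOf_eq_zero_iff, not_not]
    exact isOfFinOrder_iff_isUnit.2 ((ZMod.isUnit_iff_coprime p N).2 hNp.symm)
  have hp3 : 2 < p := by
    have := hp.two_le
    rcases hodd with ⟨k, hk⟩
    omega
  have hpq : p ∣ q := hq ▸ dvd_pow_self p hf0
  have hq2 : 2 < q := hp3.trans_le (Nat.le_of_dvd (hq ▸ pow_pos hp.pos f) hpq)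
  have hNq : N * n = q - 1 := by
    rw [hn]
    refine Nat.mul_div_cancel' ?_
    rw [← ZMod.natCast_eq_zero_iff, Nat.cast_sub (by omega), hq]
    simp [hpN]
  have hn0 : 0 < n := Nat.pos_of_ne_zero fun h => by rw [h] at hNq; omega
  have han : a * n < q - 1 := hNq ▸ Nat.mul_lt_mul_of_pos_right (by omega) hn0
  have han0 : a * n ≠ 0 := (Nat.mul_pos ha hn0).ne'
  have hB0 : 𝔅 ≠ ⊥ := by
    rintro rfl
    simp [hp.ne_zero] at hp𝔅
  have hBprime : Prime 𝔅 := Ideal.prime_of_isPrime hB0 hprime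
  have hBmax : 𝔅.IsMaximal := hprime.isMaximal hB0
  let : Field (𝓞 E ⧸ 𝔅) := Ideal.Quotient.field 𝔅
  have hchar : CharP (𝓞 E ⧸ 𝔅) p :=
    charP_of_injective_algebraMap (algebraMap (ZMod p) (𝓞 E ⧸ 𝔅)).injective p
  have hqF : ((q - 1 : ℕ) : 𝓞 E ⧸ 𝔅) ≠ 0 := by
    rw [Ne, CharP.cast_eq_zero_iff _ p]
    intro h
    have := (Nat.dvd_sub_iff_right (by omega) hpq).1 h
    exact hp.one_lt.ne' (Nat.dvd_one.1 this)
  have hωuniq {u w : 𝓞 E} := eq_of_pow_eq_one_of_map_eq (Ideal.Quotient.mk 𝔅) hqF (u := u) (w := w)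
  have hωmul (s t : 𝓞 E ⧸ 𝔅) : ω (s * t) = ω s * ω t := by
    rcases eq_or_ne s 0 with rfl | hs
    · simp [hω0]
    rcases eq_or_ne t 0 with rfl | ht
    · simp [hω0]
    refine hωuniq (hωroot _ (mul_ne_zero hs ht)) ?_ (by simp [hωlift])
    rw [mul_pow, hωroot s hs, hωroot t ht, one_mul]
  have hω1 : ω 1 = 1 := hωuniq (hωroot 1 one_ne_zero) (one_pow _) (by simp [hωlift])
  let θ : MulChar (𝓞 E ⧸ 𝔅) (𝓞 E) :=
    { toFun := fun x => ω x⁻¹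
      map_one' := by simp [hω1]
      map_mul' := fun s t => by rw [mul_inv, hωmul]
      map_nonunit' := fun s hs => by simp_all }
  have hθ (x) : Ideal.Quotient.mk 𝔅 (θ x) = x⁻¹ := hωlift _
  have hsum : (∑ x ∈ Finset.univ.filter (fun x : 𝓞 E ⧸ 𝔅 => x ≠ 0),
      ω x ^ ((N - a) * n) * ζp ^ (Algebra.trace (ZMod p) (𝓞 E ⧸ 𝔅) x).val) =
      gaussSum (θ ^ (a * n)) (AddChar.ofTrace (𝓞 E ⧸ 𝔅) hζp.pow_eq_one) := by
    rw [gaussSum, Finset.sum_filter]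
    refine Finset.sum_congr rfl fun x _ => ?_
    rw [MulChar.pow_apply' _ han0, AddChar.ofTrace_apply]
    change _ = ω x⁻¹ ^ (a * n) * _
    split_ifs with hx
    · congr 1
      have hinv : ω x * ω x⁻¹ = 1 := by rw [← hωmul, mul_inv_cancel₀ hx, hω1]
      have hsplit : (N - a) * n + a * n = q - 1 := by
        rw [← add_mul, Nat.sub_add_cancel (by omega), hNq]
      calc ω x ^ ((N - a) * n)
          = ω x ^ ((N - a) * n) * (ω x * ω x⁻¹) ^ (a * n) := by rw [hinv, one_pow, mul_one]
        _ = ω x ^ ((N - a) * n + a * n) * ω x⁻¹ ^ (a * n) := by rw [mul_pow, pow_add, mul_assoc]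
        _ = ω x⁻¹ ^ (a * n) := by rw [hsplit, hωroot x hx, one_mul]
    · rw [not_not.1 hx, inv_zero, hω0, zero_pow han0, zero_mul]
  have : NeZero p := ⟨hp.ne_zero⟩
  have : NeZero (q - 1) := ⟨by omega⟩
  have hcop : p.Coprime (q - 1) :=
    (Nat.Prime.coprime_iff_not_dvd hp).2 fun h => hqF ((CharP.cast_eq_zero_iff _ p _).2 h)
  have hcyc : IsCyclotomicExtension {p * (q - 1)} ℚ E :=
    IsPrimitiveRoot.isCyclotomicExtension_mul_of_adjoin_eq_top hcop
      (hζp.map_of_injective RingOfIntegers.coe_injective)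
      (hζ.map_of_injective RingOfIntegers.coe_injective) (by rw [Set.pair_comm]; exact hgen)
  have hker : RingHom.ker (Ideal.Quotient.mk 𝔅) = 𝔅 := Ideal.mk_ker
  have hζmem : ζp - 1 ∈ 𝔅 := by
    rw [← Ideal.Quotient.eq_zero_iff_mem, map_sub, map_one, sub_eq_zero]
    exact (Ideal.Quotient.mk 𝔅).map_eq_one_of_pow_char_eq_one p hζp.pow_eq_one
  have hv1 : emultiplicity 𝔅 (Ideal.span {ζp - 1}) = (1 : ℕ) := by
    rw [emultiplicity_eq_coe, Ideal.dvd_span_singleton, Ideal.dvd_span_singleton, pow_one]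
    exact ⟨hζmem, hζp.sub_one_notMem_sq hp hcop 𝔅 hp𝔅⟩
  have hmain := emultiplicity_gaussSum_pow (Ideal.Quotient.mk 𝔅) hθ (by rwa [hker])
    hζp.pow_eq_one (by rwa [hcard]) (a * n) han0 (by rwa [hcard])
  rw [hker, hv1, Nat.cast_one, mul_one, ← hsum, emultiplicity_eq_coe, Ideal.dvd_span_singleton,
    Ideal.dvd_span_singleton] at hmain
  exact hmain
end

section
/- Stickelberger's congruence, exact form: for every integer a with 1 ≤ a ≤ N−1, one has t(an)·G(χ^{−a}) ≡ −π^{S(an)} (mod 𝔅^{S(an)+1}), where π = ζ_p − 1; equivalently, t(an)·G(χ^{−a}) + (ζ_p − 1)^{S(an)} ∈ 𝔅^{S(an)+1}. -/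
open NumberField

/-- The product `t(a) = c₀!·c₁!·⋯·c_{f−1}!` of the factorials of the base-`p`
digits of `a`. -/
def digitFacProd (p a : ℕ) : ℕ := ((Nat.digits p a).map Nat.factorial).prod

section Digits

variable {p : ℕ}

lemma digitSum_mul_left (hp : 1 < p) (k : ℕ) : digitSum p (p * k) = digitSum p k := by
  rcases k.eq_zero_or_pos with rfl | hk
  · simp
  · simp [digitSum, Nat.digits_base_mul hp hk]

lemma digitFacProd_mul_left (hp : 1 < p) (k : ℕ) :
    digitFacProd p (p * k) = digitFacProd p k := by
  rcases k.eq_zero_or_pos with rfl | hk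
  · simp
  · simp [digitFacProd, Nat.digits_base_mul hp hk]

lemma succ_mod_div_of_not_dvd {k : ℕ} (hk : ¬ p ∣ k + 1) :
    (k + 1) % p = k % p + 1 ∧ (k + 1) / p = k / p := by
  refine ⟨?_, Nat.succ_div_of_not_dvd hk⟩
  have h1 := Nat.div_add_mod (k + 1) p
  have h2 := Nat.div_add_mod k p
  rw [Nat.succ_div_of_not_dvd hk] at h1
  omega

lemma digitSum_eq (hp : 1 < p) (k : ℕ) : digitSum p k = k % p + digitSum p (k / p) := by
  rcases k.eq_zero_or_pos with rfl | hk
  · simp [digitSum]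
  · simp [digitSum, Nat.digits_def' hp hk]

lemma digitFacProd_eq (hp : 1 < p) (k : ℕ) :
    digitFacProd p k = (k % p).factorial * digitFacProd p (k / p) := by
  rcases k.eq_zero_or_pos with rfl | hk
  · simp [digitFacProd]
  · simp [digitFacProd, Nat.digits_def' hp hk]

lemma digitSum_succ (hp : 1 < p) {k : ℕ} (hk : ¬ p ∣ k + 1) :
    digitSum p (k + 1) = digitSum p k + 1 := by
  obtain ⟨h1, h2⟩ := succ_mod_div_of_not_dvd hk
  rw [digitSum_eq hp (k + 1), digitSum_eq hp k, h1, h2]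
  ring

lemma digitFacProd_succ (hp : 1 < p) {k : ℕ} (hk : ¬ p ∣ k + 1) :
    digitFacProd p (k + 1) = ((k + 1) % p) * digitFacProd p k := by
  obtain ⟨h1, h2⟩ := succ_mod_div_of_not_dvd hk
  rw [digitFacProd_eq hp (k + 1), digitFacProd_eq hp k, h1, h2, Nat.factorial_succ, mul_assoc]

lemma not_dvd_digitFacProd (hp : p.Prime) (k : ℕ) : ¬ p ∣ digitFacProd p k := by
  rw [digitFacProd, hp.prime.dvd_prod_iff]
  rintro ⟨_, ha, hdvd⟩
  obtain ⟨d, hd, rfl⟩ := List.mem_map.1 ha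
  exact (Nat.digits_lt_base hp.one_lt hd).not_ge (hp.dvd_factorial.1 hdvd)

end Digits

section FiniteFieldSums

variable {F : Type*} [Field F] [Fintype F]

lemma sum_inv_mul_one_sub_inv_pow {k : ℕ} (hk : k ≠ 0) (hkq : k + 1 < Fintype.card F - 1) :
    ∑ x : F, x⁻¹ * ((1 - x)⁻¹) ^ k = -((k + 1 : ℕ) : F) := by
  classical
  have hbij : Function.Bijective fun x : F => (1 - x)⁻¹ :=
    inv_involutive.bijective.comp (Equiv.subLeft (1 : F)).bijective
  have hterm (x : F) : x⁻¹ * ((1 - x)⁻¹) ^ k =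
      (fun y : F => y ^ (k + 1) * (y - 1)⁻¹) ((1 - x)⁻¹) := by
    by_cases hx : 1 - x = 0
    · simp [hx, hk]
    · by_cases hx0 : x = 0
      · simp [hx0]
      have : (1 - x)⁻¹ - 1 = x * (1 - x)⁻¹ := by field_simp; ring
      simp only [this, mul_inv, inv_inv, pow_succ]
      field_simp
  have hgeom (y : F) : y ^ (k + 1) * (y - 1)⁻¹ =
      (∑ i ∈ Finset.range (k + 1), y ^ i) + (y - 1)⁻¹ - if y = 1 then ((k + 1 : ℕ) : F) else 0 := by
    by_cases hy : y = 1
    · simp [hy]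
    · have h : y - 1 ≠ 0 := sub_ne_zero.2 hy
      rw [geom_sum_eq hy, if_neg hy]
      field_simp
      ring
  have hinv : ∑ y : F, (y - 1)⁻¹ = 0 := by
    have h1 : ∑ y : F, (y - 1)⁻¹ = ∑ y : F, y ^ 1 := by
      simp only [pow_one]
      exact Function.Bijective.sum_comp
        (inv_involutive.bijective.comp (Equiv.subRight (1 : F)).bijective) id
    rw [h1, FiniteField.sum_pow_lt_card_sub_one _ _ (by omega)]
  rw [Finset.sum_congr rfl fun x _ => hterm x,
    hbij.sum_comp (fun y : F => y ^ (k + 1) * (y - 1)⁻¹), Finset.sum_congr rfl fun y _ => hgeom y,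
    Finset.sum_sub_distrib, Finset.sum_add_distrib, hinv, Finset.sum_comm,
    Finset.sum_eq_zero fun i hi => FiniteField.sum_pow_lt_card_sub_one F i
      (by have := Finset.mem_range.1 hi; omega)]
  simp

lemma sum_inv_mul_trace {p : ℕ} [Fact p.Prime] [Algebra (ZMod p) F] :
    ∑ x : F, x⁻¹ * algebraMap (ZMod p) F (Algebra.trace (ZMod p) F x) = -1 := by
  classical
  have hp : 1 < p := (Fact.out : p.Prime).one_lt
  have hcard : Fintype.card F = p ^ Module.finrank (ZMod p) F := by
    rw [Module.card_eq_pow_finrank (K := ZMod p), ZMod.card]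
  have hpos : 0 < Module.finrank (ZMod p) F := Module.finrank_pos
  simp_rw [FiniteField.algebraMap_trace_eq_sum_pow, Nat.card_zmod, Finset.mul_sum]
  rw [Finset.sum_comm, Finset.sum_eq_single_of_mem 0 (Finset.mem_range.2 hpos)]
  · have : ∀ x : F, x⁻¹ * x ^ p ^ 0 = 1 - if x = 0 then 1 else 0 := by
      intro x
      by_cases hx : x = 0 <;> simp [hx]
    rw [Finset.sum_congr rfl fun x _ => this x]
    simp
  · intro i hi hi0
    have hlt : p ^ i < Fintype.card F := by
      rw [hcard]
      exact Nat.pow_lt_pow_right hp (Finset.mem_range.1 hi)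
    have hgt : 1 < p ^ i := Nat.one_lt_pow hi0 hp
    rw [← FiniteField.sum_pow_lt_card_sub_one F (p ^ i - 1) (by omega)]
    refine Finset.sum_congr rfl fun x _ => ?_
    by_cases hx : x = 0
    · simp [hx, Nat.sub_ne_zero_of_lt hgt]
    · rw [← div_eq_inv_mul, div_eq_iff hx, ← pow_succ, Nat.sub_add_cancel hgt.le]

end FiniteFieldSums

section Teichmuller

variable {R F : Type*} [CommRing R] [IsDomain R] [Field F] [Fintype F]

/-- The multiplicative character given by a multiplicative section of the reduction map whose
nonzero values are `(q - 1)`-st roots of unity. -/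
noncomputable def teichmullerChar (red : R →+* F) (ω : F → R) (hω0 : ω 0 = 0)
    (hroot : ∀ t ≠ 0, ω t ^ (Fintype.card F - 1) = 1) (hlift : ∀ t, red (ω t) = t) :
    MulChar F R :=
  have key : ∀ u : R, u ^ (Fintype.card F - 1) = 1 → ω (red u) = u := by
    classical
    intro u hu
    have hq : 0 < Fintype.card F - 1 := Nat.sub_pos_of_lt Fintype.one_lt_card
    have hinj : Function.Injective ω := Function.LeftInverse.injective hlift
    have hsub : (Finset.univ.erase (0 : F)).image ω ⊆
        Polynomial.nthRootsFinset (Fintype.card F - 1) (1 : R) := by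
      intro v hv
      obtain ⟨t, ht, rfl⟩ := Finset.mem_image.1 hv
      exact (Polynomial.mem_nthRootsFinset hq 1).2 (hroot t (Finset.ne_of_mem_erase ht))
    have heq := Finset.eq_of_subset_of_card_le hsub (by
      rw [Finset.card_image_of_injective _ hinj, Finset.card_erase_of_mem (Finset.mem_univ _),
        Finset.card_univ, Polynomial.nthRootsFinset_def]
      exact (Multiset.toFinset_card_le _).trans (Polynomial.card_nthRoots _ _))
    have hmem := (Polynomial.mem_nthRootsFinset hq (1 : R)).2 hu
    rw [← heq] at hmem
    obtain ⟨t, -, rfl⟩ := Finset.mem_image.1 hmem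
    rw [hlift]
  { toFun := ω
    map_one' := by simpa using key 1 (one_pow _)
    map_mul' := by
      intro x y
      rcases eq_or_ne x 0 with rfl | hx
      · simp [hω0]
      rcases eq_or_ne y 0 with rfl | hy
      · simp [hω0]
      simpa [hlift] using key (ω x * ω y) (by rw [mul_pow, hroot x hx, hroot y hy, one_mul])
    map_nonunit' := by
      intro x hx
      rw [isUnit_iff_ne_zero, not_not] at hx
      rw [hx, hω0] }

end Teichmuller

section GaussSums

variable {R F : Type*} [CommRing R] [Field F] {red : R →+* F} {ω : MulChar F R}
  {p : ℕ} [Fact p.Prime] [Algebra (ZMod p) F] {ζ : R} (hζ : ζ ^ p = 1)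

/-- The additive character `x ↦ ζ ^ Tr(x)`. -/
noncomputable def traceChar (F : Type*) [Field F] [Algebra (ZMod p) F] : AddChar F R :=
  (AddChar.zmodChar p hζ).compAddMonoidHom (Algebra.trace (ZMod p) F).toAddMonoidHom

lemma traceChar_apply (x : F) :
    traceChar hζ F x = ζ ^ (Algebra.trace (ZMod p) F x).val := rfl

include hζ in
lemma zeta_sub_one_mem_ker : ζ - 1 ∈ RingHom.ker red := by
  have : CharP F p := charP_of_injective_algebraMap (algebraMap (ZMod p) F).injective p
  have h : (red (ζ - 1)) ^ p = 0 := by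
    rw [map_sub, map_one, sub_pow_char, ← map_pow, hζ, map_one, one_pow, sub_self]
  exact RingHom.mem_ker.2 (pow_eq_zero_iff (Fact.out : p.Prime).ne_zero |>.1 h)

lemma mul_mem_ker_pow_imp (hred : Function.Surjective red) {u x : R} {n : ℕ} (hu : red u ≠ 0)
    (h : u * x ∈ RingHom.ker red ^ n) : x ∈ RingHom.ker red ^ n := by
  have := RingHom.ker_isMaximal_of_surjective red hred
  exact (Ideal.IsMaximal.mul_mem_pow _ h).resolve_left fun h' => hu (RingHom.mem_ker.1 h')

lemma red_inv_pow_apply (hω : ∀ x, red (ω x) = x) {k : ℕ} (hk : k ≠ 0) (x : F) :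
    red ((ω⁻¹ ^ k) x) = (x⁻¹) ^ k := by
  rw [MulChar.pow_apply' _ hk, map_pow, MulChar.inv_apply', hω]

variable [Fintype F]

lemma inv_pow_ne_one (hω : ∀ x, red (ω x) = x) {k : ℕ} (hk : k ≠ 0)
    (hkq : k < Fintype.card F - 1) : ω⁻¹ ^ k ≠ 1 := by
  classical
  intro h
  refine Nat.not_dvd_of_pos_of_lt (Nat.pos_of_ne_zero hk) hkq
    ((FiniteField.forall_pow_eq_one_iff F k).1 fun x => ?_)
  have h1 := red_inv_pow_apply hω hk ((x⁻¹ : Fˣ) : F)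
  rw [h, MulChar.one_apply_coe, map_one] at h1
  ext
  simpa using h1.symm

lemma gaussSum_inv_pow_mul (k : ℕ) (hk : k ≠ 0) :
    gaussSum (ω⁻¹ ^ (p * k)) (traceChar hζ F) = gaussSum (ω⁻¹ ^ k) (traceChar hζ F) := by
  have hp : p ≠ 0 := (Fact.out : p.Prime).ne_zero
  let e := FiniteField.frobeniusAlgEquivOfAlgebraic (ZMod p) F
  have he (x : F) : e x = x ^ p := by
    simp [e, ZMod.card]
  rw [gaussSum, gaussSum, ← e.toEquiv.sum_comp fun x => (ω⁻¹ ^ k) x * traceChar hζ F x]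
  refine Finset.sum_congr rfl fun x _ => ?_
  change _ = (ω⁻¹ ^ k) (e x) * traceChar hζ F (e x)
  rw [traceChar_apply, traceChar_apply, Algebra.trace_eq_of_algEquiv, he,
    MulChar.pow_apply' _ (mul_ne_zero hp hk), MulChar.pow_apply' _ hk, map_pow, pow_mul]

lemma gaussSum_inv_add_mem [IsDomain R] (hω : ∀ x, red (ω x) = x)
    (hq : 2 < Fintype.card F) :
    gaussSum (ω⁻¹ ^ 1) (traceChar hζ F) + (ζ - 1) ∈ RingHom.ker red ^ 2 := by
  set π := ζ - 1 with hπ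
  have hmem : π ∈ RingHom.ker red := zeta_sub_one_mem_ker (red := red) hζ
  have hpow (m : ℕ) : ζ ^ m - (1 + m * π) ∈ RingHom.ker red ^ 2 := by
    have hdvd : π ^ 2 ∣ ζ ^ m - (1 + m * π) := by
      have hζπ : ζ = π + 1 := by rw [hπ]; ring
      obtain ⟨c, hc⟩ := Polynomial.powAddExpansion (1 : R) π m
      refine ⟨c, ?_⟩
      rw [hζπ, add_comm π 1, hc]
      simp
      ring
    exact Ideal.mem_of_dvd _ hdvd (Ideal.pow_mem_pow hmem 2)
  let T : F → ℕ := fun x => (Algebra.trace (ZMod p) F x).val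
  have hsum0 : ∑ x, ω⁻¹ x = 0 := MulChar.sum_eq_zero_of_ne_one
    (by simpa using inv_pow_ne_one hω one_ne_zero (by omega))
  have hlin : ∑ x, ω⁻¹ x * (T x : R) + 1 ∈ RingHom.ker red := by
    rw [RingHom.mem_ker, map_add, map_sum, map_one, ← eq_neg_iff_add_eq_zero,
      ← sum_inv_mul_trace (F := F) (p := p)]
    refine Finset.sum_congr rfl fun x _ => ?_
    rw [map_mul, map_natCast, MulChar.inv_apply', hω, ← map_natCast (algebraMap (ZMod p) F),
      ZMod.natCast_zmod_val]
  have hdecomp : gaussSum (ω⁻¹ ^ 1) (traceChar hζ F) + π =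
      ∑ x, ω⁻¹ x * (ζ ^ T x - (1 + T x * π)) + π * (∑ x, ω⁻¹ x * (T x : R) + 1) := by
    have : ∑ x, ω⁻¹ x * (ζ ^ T x - (1 + T x * π)) =
        ∑ x, ω⁻¹ x * ζ ^ T x - (∑ x, ω⁻¹ x + π * ∑ x, ω⁻¹ x * (T x : R)) := by
      rw [Finset.mul_sum, ← Finset.sum_add_distrib, ← Finset.sum_sub_distrib]
      exact Finset.sum_congr rfl fun x _ => by ring
    rw [this, hsum0, pow_one, gaussSum]
    simp only [traceChar_apply, T]
    ring
  rw [hdecomp]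
  refine add_mem (sum_mem fun x _ => Ideal.mul_mem_left _ _ (hpow _)) ?_
  rw [pow_two]
  exact Ideal.mul_mem_mul hmem hlin

lemma red_jacobiSum (hω : ∀ x, red (ω x) = x) {k : ℕ} (hk : k ≠ 0)
    (hkq : k + 1 < Fintype.card F - 1) :
    red (jacobiSum ω⁻¹ (ω⁻¹ ^ k)) = -((k + 1 : ℕ) : F) := by
  rw [← sum_inv_mul_one_sub_inv_pow hk hkq, jacobiSum, map_sum]
  refine Finset.sum_congr rfl fun x _ => ?_
  rw [map_mul, red_inv_pow_apply hω hk, MulChar.inv_apply', hω]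

/-- Stickelberger's congruence for a Teichmüller character. -/
theorem digitFacProd_mul_gaussSum_add_mem [IsDomain R] (hω : ∀ x, red (ω x) = x)
    (k : ℕ) (hk : k ≠ 0) (hkq : k < Fintype.card F - 1) :
    (digitFacProd p k : R) * gaussSum (ω⁻¹ ^ k) (traceChar hζ F) + (ζ - 1) ^ digitSum p k ∈
      RingHom.ker red ^ (digitSum p k + 1) := by
  have hp : p.Prime := Fact.out
  have hred : Function.Surjective red := fun x => ⟨ω x, hω x⟩
  have hchar : CharP F p := charP_of_injective_algebraMap (algebraMap (ZMod p) F).injective p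
  have hπ : ζ - 1 ∈ RingHom.ker red := zeta_sub_one_mem_ker (red := red) hζ
  have h1 := gaussSum_inv_add_mem hζ hω (by omega)
  induction k using Nat.strong_induction_on with
  | _ k ih =>
  by_cases hpk : p ∣ k
  · obtain ⟨j, rfl⟩ := hpk
    have hj : j ≠ 0 := right_ne_zero_of_mul hk
    have hlt : j < p * j := lt_mul_of_one_lt_left (Nat.pos_of_ne_zero hj) hp.one_lt
    rw [digitSum_mul_left hp.one_lt, digitFacProd_mul_left hp.one_lt, gaussSum_inv_pow_mul hζ j hj]
    exact ih j hlt hj (hlt.trans hkq)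
  obtain ⟨j, rfl⟩ := Nat.exists_eq_succ_of_ne_zero hk
  rw [Nat.succ_eq_add_one] at *
  rcases eq_or_ne j 0 with rfl | hj
  · simpa [digitSum, digitFacProd, Nat.digits_of_lt p 1 one_ne_zero hp.one_lt] using h1
  have hprev := ih j (Nat.lt_succ_self j) hj (by omega)
  have hJ := jacobiSum_mul_nontrivial (χ := ω⁻¹) (φ := ω⁻¹ ^ j)
    (by rw [← pow_succ']; exact inv_pow_ne_one hω hk hkq) (traceChar hζ F)
  rw [← pow_succ'] at hJ
  have hJred := red_jacobiSum hω hj hkq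
  rw [pow_one] at h1
  rw [digitSum_succ hp.one_lt hpk]
  set P := RingHom.ker red
  set s := digitSum p j
  set t := digitFacProd p j
  set G := gaussSum (ω⁻¹ ^ (j + 1)) (traceChar hζ F)
  set G₁ := gaussSum ω⁻¹ (traceChar hζ F)
  set Gj := gaussSum (ω⁻¹ ^ j) (traceChar hζ F)
  set J := jacobiSum ω⁻¹ (ω⁻¹ ^ j)
  set π := ζ - 1
  have hprod : t * J * G - π ^ (s + 1) ∈ P ^ (s + 1 + 1) := by
    have hG₁ : G₁ ∈ P := by
      have := sub_mem (Ideal.pow_le_self two_ne_zero h1) hπ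
      rwa [add_sub_cancel_right] at this
    have e : t * J * G - π ^ (s + 1) =
        G₁ * (t * Gj + π ^ s) - (G₁ + π) * π ^ s := by
      linear_combination (t : R) * hJ
    rw [e]
    refine sub_mem ?_ ?_
    · rw [pow_succ' P (s + 1)]
      exact Ideal.mul_mem_mul hG₁ hprev
    · rw [add_assoc, add_comm s, pow_add]
      exact Ideal.mul_mem_mul h1 (Ideal.pow_mem_pow hπ s)
  have ht : (t : F) ≠ 0 := by
    rw [Ne, CharP.cast_eq_zero_iff F p]
    exact not_dvd_digitFacProd hp j
  have hj1 : ((j + 1 : ℕ) : F) ≠ 0 := by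
    rwa [Ne, CharP.cast_eq_zero_iff F p]
  have hG : G ∈ P ^ (s + 1) := by
    refine mul_mem_ker_pow_imp hred (u := t * J) ?_ ?_
    · rw [map_mul, map_natCast, hJred]
      exact mul_ne_zero ht (neg_ne_zero.2 hj1)
    · have := add_mem (Ideal.pow_le_pow_right (Nat.le_succ _) hprod) (Ideal.pow_mem_pow hπ (s + 1))
      rwa [sub_add_cancel] at this
  have hJP : (((j + 1) % p : ℕ) : R) + J ∈ P := by
    rw [RingHom.mem_ker, map_add, map_natCast, hJred, CharP.cast_eq_mod F p (j + 1)]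
    ring
  have e : (digitFacProd p (j + 1) : R) * G + π ^ (s + 1) =
      t * ((((j + 1) % p : ℕ) : R) + J) * G - (t * J * G - π ^ (s + 1)) := by
    rw [digitFacProd_succ hp.one_lt hpk]
    push_cast
    ring
  rw [e]
  refine sub_mem ?_ hprod
  rw [pow_succ']
  exact Ideal.mul_mem_mul (Ideal.mul_mem_left _ _ hJP) hG

end GaussSums

/-- **Stickelberger's congruence, exact form.**
Let `p` be an odd prime, `N ≥ 2` with `gcd(N,p) = 1`, `f` the order of `p` mod `N`,
`q = p^f`, `n = (q−1)/N`.  Let `E = ℚ(ζ_{q−1}, ζ_p)` (a number field generated over `ℚ`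
by a primitive `(q−1)`-st root of unity `ζ` and a primitive `p`-th root of unity `ζp`),
and let `𝔅` be the prime ideal of `𝓞 E` above `p` (with residue field `F_q`).
Let `ω` be the Teichmüller map: the inverse of the reduction bijection from the
`(q−1)`-st roots of unity onto the nonzero residues (with `ω 0 = 0`), and let
`χ = ω^n` be the associated multiplicative character of order `N`.
Then for `1 ≤ a ≤ N − 1`, with `π = ζp − 1`, one has
`t(an)·G(χ^{−a}) ≡ −π^(S(an)) (mod 𝔅^(S(an)+1))`, where
`G(χ^{−a}) = ∑_{x ≠ 0} ω(x)^{(N−a)n} ζp^{T(x)}`; equivalently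
`t(an)·G(χ^{−a}) + (ζp − 1)^(S(an)) ∈ 𝔅^(S(an)+1)`. -/
theorem stickelberger_congruence_exact
    (p N f q n : ℕ) (hp : p.Prime) (hodd : Odd p)
    (hN : 2 ≤ N) (hNp : Nat.Coprime N p)
    (hf : orderOf (p : ZMod N) = f) (hq : q = p ^ f) (hn : n = (q - 1) / N)
    (E : Type) [Field E] [NumberField E]
    (ζ ζp : 𝓞 E)
    (hζ : IsPrimitiveRoot ζ (q - 1)) (hζp : IsPrimitiveRoot ζp p)
    (hgen : Algebra.adjoin ℚ {(ζ : E), (ζp : E)} = ⊤)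
    (𝔅 : Ideal (𝓞 E)) (hprime : 𝔅.IsPrime) (hp𝔅 : (p : 𝓞 E) ∈ 𝔅)
    [Fintype (𝓞 E ⧸ 𝔅)] [DecidableEq (𝓞 E ⧸ 𝔅)]
    (hcard : Fintype.card (𝓞 E ⧸ 𝔅) = q)
    [Algebra (ZMod p) (𝓞 E ⧸ 𝔅)]
    (ω : (𝓞 E ⧸ 𝔅) → 𝓞 E)
    (hω0 : ω 0 = 0)
    (hωroot : ∀ t : 𝓞 E ⧸ 𝔅, t ≠ 0 → ω t ^ (q - 1) = 1)
    (hωlift : ∀ t : 𝓞 E ⧸ 𝔅, Ideal.Quotient.mk 𝔅 (ω t) = t) :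
    ∀ a : ℕ, 1 ≤ a → a ≤ N - 1 →
      (digitFacProd p (a * n) : 𝓞 E) *
          (∑ x ∈ Finset.univ.filter (fun x : 𝓞 E ⧸ 𝔅 => x ≠ 0),
            ω x ^ ((N - a) * n) * ζp ^ (Algebra.trace (ZMod p) (𝓞 E ⧸ 𝔅) x).val) +
        (ζp - 1) ^ digitSum p (a * n)
      ∈ 𝔅 ^ (digitSum p (a * n) + 1) := by
  intro a ha haN
  have : Fact p.Prime := ⟨hp⟩
  subst hf hq hn
  have : IsDomain (𝓞 E ⧸ 𝔅) := Ideal.Quotient.isDomain 𝔅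
  have : 𝔅.IsMaximal := Ideal.Quotient.maximal_of_isField 𝔅 (Finite.isField_of_domain _)
  let _ := Ideal.Quotient.field 𝔅
  set q := p ^ orderOf (p : ZMod N)
  have : NeZero N := ⟨by omega⟩
  have hdvd : N ∣ q - 1 := by
    rw [← CharP.cast_eq_zero_iff (ZMod N) N, Nat.cast_sub (Nat.one_le_pow _ _ hp.pos)]
    simp [pow_orderOf_eq_one]
  have hq1 : 0 < q - 1 := by
    have := Fintype.one_lt_card (α := 𝓞 E ⧸ 𝔅)
    omega
  obtain ⟨n, hn⟩ := hdvd
  have hnq : (q - 1) / N = n := by rw [hn, Nat.mul_div_cancel_left _ (NeZero.pos N)]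
  have hn0 : n ≠ 0 := by rintro rfl; omega
  rw [hnq]
  have hlt : a * n < q - 1 := hn ▸ Nat.mul_lt_mul_of_pos_right (by omega) (Nat.pos_of_ne_zero hn0)
  have hsub : (N - a) * n = q - 1 - a * n := by rw [Nat.sub_mul, hn]
  let χ := teichmullerChar (Ideal.Quotient.mk 𝔅) ω hω0 (by rwa [hcard]) hωlift
  have hχ (x : 𝓞 E ⧸ 𝔅) : χ x = ω x := rfl
  have hmain := digitFacProd_mul_gaussSum_add_mem (red := Ideal.Quotient.mk 𝔅) (ω := χ)
    hζp.pow_eq_one hωlift (a * n) (by positivity) (by rwa [hcard])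
  have hpow : χ ^ (q - 1) = 1 := by
    ext x
    rw [MulChar.pow_apply_coe, MulChar.one_apply_coe, hχ, hωroot _ x.ne_zero]
  have hinv : χ⁻¹ ^ (a * n) = χ ^ ((N - a) * n) := by
    rw [inv_pow, inv_eq_iff_mul_eq_one, ← pow_add, hsub, Nat.add_sub_cancel' hlt.le, hpow]
  rw [Ideal.mk_ker] at hmain
  convert hmain using 3
  rw [hinv, gaussSum, Finset.sum_filter]
  refine Finset.sum_congr rfl fun x _ => ?_
  have h0 : (N - a) * n ≠ 0 := by omega
  rw [MulChar.pow_apply' _ h0, traceChar_apply, hχ]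
  split_ifs with hx
  · rfl
  · rw [not_not.1 hx, hω0, zero_pow h0, zero_mul]
end

section
/- Sign determination in the index 2 case, form (3): assume the Gauss sum satisfies G(χ) = 2^{−y} p^x (a + b√−L) with integers a, b, x ≥ 0, y ≥ 0 and √−L ∈ ℚ(ζ_N) a fixed square root of −L. Then: (i) if S(−n) = (p−1)x, then t(−n)·(a + b√−L) ≡ (−1)^{x+1}·2^y (mod 𝔓), while if S(−n) > (p−1)x then a + b√−L ≡ 0 (mod 𝔓); (ii) if S(n) = (p−1)x, then t(n)·(a − b√−L) ≡ (−1)^{x+1}·χ(−1)·2^y (mod 𝔓), while if S(n) > (p−1)x then a − b√−L ≡ 0 (mod 𝔓). Here χ(−1) = ±1 is regarded via its residue modulo 𝔓. -/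
open NumberField

theorem digitSum_eq_mod_add (p : ℕ) (hp : 1 < p) (a : ℕ) :
    digitSum p a = a % p + digitSum p (a / p) := by
  rcases Nat.eq_zero_or_pos a with rfl | ha
  · simp [digitSum]
  · simp [digitSum, Nat.digits_def' hp ha]

theorem digitFacProd_eq_mod_mul (p : ℕ) (hp : 1 < p) (a : ℕ) :
    digitFacProd p a = (a % p).factorial * digitFacProd p (a / p) := by
  rcases Nat.eq_zero_or_pos a with rfl | ha
  · simp [digitFacProd]
  · simp [digitFacProd, Nat.digits_def' hp ha]

theorem digitSum_zero (p : ℕ) : digitSum p 0 = 0 := by simp [digitSum]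

theorem digitFacProd_zero (p : ℕ) : digitFacProd p 0 = 1 := by simp [digitFacProd]

theorem coprime_digitFacProd {p : ℕ} (hp : p.Prime) (a : ℕ) :
    Nat.Coprime p (digitFacProd p a) := by
  induction a using Nat.strong_induction_on with
  | _ a ih =>
    rcases Nat.eq_zero_or_pos a with rfl | ha
    · simp [digitFacProd_zero]
    · rw [digitFacProd_eq_mod_mul p hp.one_lt]
      exact Nat.Coprime.mul_right
        ((Nat.coprime_factorial_iff hp.ne_one).2 (by
          rw [hp.minFac_eq]; exact Nat.mod_lt _ hp.pos))
        (ih _ (Nat.div_lt_self ha hp.one_lt))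

section FiniteField

variable {F : Type*} [Field F] [Fintype F]

theorem sum_inv_pow_eq_zero (i : ℕ) (hi : i < Fintype.card F - 1) :
    ∑ x : F, x⁻¹ ^ i = 0 := by
  rw [← FiniteField.sum_pow_lt_card_sub_one F i hi]
  exact Fintype.sum_equiv (Equiv.inv F) _ _ fun x => rfl

theorem sum_inv_mul_trace_eq_neg_one (p : ℕ) [Fact p.Prime] [Algebra (ZMod p) F]
    (hF : 2 < Fintype.card F) :
    ∑ z : F, z⁻¹ * algebraMap (ZMod p) F (Algebra.trace (ZMod p) F z) = -1 := by
  classical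
  have hp := (Fact.out : p.Prime)
  have hcard : Fintype.card F = p ^ Module.finrank (ZMod p) F := by
    rw [Module.card_eq_pow_finrank (K := ZMod p), ZMod.card]
  have hpos : 0 < Module.finrank (ZMod p) F := Module.finrank_pos
  simp_rw [FiniteField.algebraMap_trace_eq_sum_pow, Finset.mul_sum]
  rw [Finset.sum_comm, Finset.sum_eq_single_of_mem 0 (Finset.mem_range.2 hpos)]
  · have h : ∀ z : F, z⁻¹ * z ^ Nat.card (ZMod p) ^ 0 = 1 - (if z = 0 then 1 else 0) := by
      intro z
      by_cases hz : z = 0 <;> simp [hz]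
    simp_rw [h]
    rw [Finset.sum_sub_distrib]
    simp
  · intro i hi hi0
    have h2 : 2 ≤ p ^ i := le_trans hp.two_le (Nat.le_self_pow hi0 p)
    have hlt : p ^ i < Fintype.card F := by
      rw [hcard]
      exact Nat.pow_lt_pow_right hp.one_lt (Finset.mem_range.1 hi)
    rw [Nat.card_zmod, ← FiniteField.sum_pow_lt_card_sub_one F (p ^ i - 1) (by omega)]
    refine Finset.sum_congr rfl fun z _ => ?_
    obtain ⟨k, hk⟩ := Nat.exists_eq_add_of_le' h2
    rw [hk]
    by_cases hz : z = 0
    · simp [hz]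
    · field_simp
      rw [Nat.add_sub_assoc one_le_two, pow_succ, pow_succ]
      ring

theorem sum_inv_pow_mul_inv_one_sub (hF : 2 < Fintype.card F) (k : ℕ) (hk : k < Fintype.card F - 1) :
    ∑ x : F, (x ^ (k + 1))⁻¹ * x * (1 - x)⁻¹ = -(k + 1 : F) := by
  classical
  induction k with
  | zero =>
    have h : ∀ x : F, (x ^ (0 + 1))⁻¹ * x * (1 - x)⁻¹ = (1 - x)⁻¹ - (if x = 0 then 1 else 0) := by
      intro x
      by_cases hx : x = 0 <;> simp [hx]
    simp_rw [h]
    have h' : ∑ x : F, (1 - x)⁻¹ = ∑ x : F, x⁻¹ ^ 1 :=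
      Fintype.sum_equiv (Equiv.subLeft (1 : F)) _ _ fun x => by simp
    rw [Finset.sum_sub_distrib, h', sum_inv_pow_eq_zero 1 (by omega)]
    simp
  | succ k ih =>
    have h : ∀ x : F, (x ^ (k + 1 + 1))⁻¹ * x * (1 - x)⁻¹ =
        (x ^ (k + 1))⁻¹ * x * (1 - x)⁻¹ + (x⁻¹) ^ (k + 1) - (if x = 1 then 1 else 0) := by
      intro x
      by_cases hx : x = 0
      · simp [hx]
      by_cases hx1 : x = 1
      · simp [hx1]
      have : 1 - x ≠ 0 := sub_ne_zero.2 (Ne.symm hx1)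
      simp only [hx1, if_false]
      simp only [inv_pow]
      field_simp
      ring
    simp_rw [h]
    rw [Finset.sum_sub_distrib, Finset.sum_add_distrib, ih (by omega),
      sum_inv_pow_eq_zero _ hk]
    simp
    ring

end FiniteField

section Stickelberger

variable {F O : Type*} [Field F] [CommRing O]

theorem map_eq_one_of_isPrimitiveRoot {p : ℕ} [Fact p.Prime] [Algebra (ZMod p) F]
    (r : O →+* F) {ζ : O} (hζ : IsPrimitiveRoot ζ p) : r ζ = 1 := by
  have : CharP F p := charP_of_injective_algebraMap (algebraMap (ZMod p) F).injective p
  have h : (r ζ - 1) ^ p = 0 := by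
    rw [sub_pow_char, ← map_pow, hζ.pow_eq_one]
    simp
  exact sub_eq_zero.1 (pow_eq_zero_iff (Fact.out : p.Prime).ne_zero |>.1 h)

theorem exists_prime_eq_sub_one_pow_mul {p : ℕ} [Fact p.Prime] [Algebra (ZMod p) F]
    [IsDomain O] (r : O →+* F) (hodd : Odd p) {ζ : O} (hζ : IsPrimitiveRoot ζ p) :
    ∃ w : O, r w = -1 ∧ (p : O) = (ζ - 1) ^ (p - 1) * w := by
  have hp := (Fact.out : p.Prime)
  obtain ⟨m, hm⟩ : ∃ m, p = m + 1 := ⟨p - 1, by have := hp.pos; omega⟩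
  refine ⟨∏ k ∈ Finset.range m, ∑ i ∈ Finset.range (k + 1), ζ ^ i, ?_, ?_⟩
  · have h : (∏ k ∈ Finset.range m, (k + 1)) = (p - 1).factorial := by
      rw [Finset.prod_range_add_one_eq_factorial, hm, Nat.add_sub_cancel]
    have h1 : (((p - 1).factorial : ℕ) : F) = -1 := by
      have := congrArg (algebraMap (ZMod p) F) (ZMod.wilsons_lemma p)
      rwa [map_natCast, map_neg, map_one] at this
    simp only [map_prod, map_sum, map_pow, map_eq_one_of_isPrimitiveRoot r hζ, one_pow,
      Finset.sum_const, Finset.card_range, nsmul_eq_mul, mul_one]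
    rw [← h1, ← h, Nat.cast_prod]
  · have h := IsPrimitiveRoot.prod_one_sub_pow_eq_order (n := m) (hm ▸ hζ)
    have h2 : ((p : ℕ) : O) = (m : O) + 1 := by rw [hm]; push_cast; ring
    have he : Even m := by
      rcases Nat.even_or_odd m with he | ho
      · exact he
      · exact absurd (hm ▸ hodd) (Nat.not_odd_iff_even.2 ho.add_one)
    have h3 : p - 1 = m := by omega
    rw [h2, h3, ← h, ← he.neg_pow, neg_sub, ← Finset.card_range m, ← Finset.prod_const,
      Finset.card_range, ← Finset.prod_mul_distrib]
    exact Finset.prod_congr rfl fun k _ => (mul_neg_geom_sum ζ (k + 1)).symm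

theorem map_teichmuller_pow_inv_apply {r : O →+* F} {χ : MulChar F O} (hχ : ∀ t, r (χ t) = t)
    (k : ℕ) (x : F) : r ((χ ^ k)⁻¹ x) = (x ^ (k + 1))⁻¹ * x := by
  rw [MulChar.inv_apply']
  by_cases hx : x = 0
  · simp [hx, MulChar.map_zero]
  · have hu : IsUnit (x⁻¹) := (Ne.isUnit hx).inv
    rw [← hu.unit_spec, MulChar.pow_apply_coe, hu.unit_spec, map_pow, hχ, inv_pow, pow_succ,
      mul_inv, mul_assoc, inv_mul_cancel₀ hx, mul_one]

variable [Fintype F]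

theorem teichmuller_pow_ne_one {r : O →+* F} {χ : MulChar F O} (hχ : ∀ t, r (χ t) = t)
    {a : ℕ} (ha0 : 0 < a) (ha : a < Fintype.card F - 1) : χ ^ a ≠ 1 := by
  intro h
  have h1 : ∀ t : Fˣ, t ^ a = 1 := by
    intro t
    have := congrArg (fun φ : MulChar F O => r (φ t)) h
    simp only [MulChar.pow_apply_coe, map_pow, hχ, MulChar.one_apply_coe, map_one] at this
    exact Units.ext (by simpa using this)
  exact absurd (Nat.le_of_dvd ha0 ((FiniteField.forall_pow_eq_one_iff F a).1 h1)) (by omega)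

theorem gaussSum_pow_prime {p : ℕ} [Fact p.Prime] [Algebra (ZMod p) F] (χ : MulChar F O)
    {ψ : AddChar F O} {ζ : O} (hψ : ∀ z, ψ z = ζ ^ (Algebra.trace (ZMod p) F z).val) :
    gaussSum (χ ^ p) ψ = gaussSum χ ψ := by
  have hp := (Fact.out : p.Prime)
  have : CharP F p := charP_of_injective_algebraMap (algebraMap (ZMod p) F).injective p
  refine Fintype.sum_equiv (FiniteField.frobeniusAlgEquivOfAlgebraic (ZMod p) F).toEquiv _ _
    fun x => ?_
  have h : (FiniteField.frobeniusAlgEquivOfAlgebraic (ZMod p) F).toEquiv x = x ^ p := by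
    simp
  rw [hψ, hψ, MulChar.pow_apply' χ hp.ne_zero, ← map_pow, h]
  congr 3
  rw [← h]
  exact (Algebra.trace_eq_of_algEquiv _ x).symm

theorem map_jacobiSum_teichmuller {r : O →+* F} {χ : MulChar F O} (hχ : ∀ t, r (χ t) = t)
    (hF : 2 < Fintype.card F) {k : ℕ} (hk : k < Fintype.card F - 1) :
    r (jacobiSum (χ ^ k)⁻¹ χ⁻¹) = -(k + 1 : F) := by
  rw [← sum_inv_pow_mul_inv_one_sub hF k hk, jacobiSum, map_sum]
  refine Finset.sum_congr rfl fun x _ => ?_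
  rw [map_mul, map_teichmuller_pow_inv_apply hχ, MulChar.inv_apply', hχ]

variable [IsDomain O]

variable {p : ℕ} [Fact p.Prime] [Algebra (ZMod p) F]

theorem exists_gaussSum_teichmuller_inv_eq {r : O →+* F} {χ : MulChar F O}
    (hχ : ∀ t, r (χ t) = t) (hF : 2 < Fintype.card F) {ψ : AddChar F O} {ζ : O}
    (hζ : IsPrimitiveRoot ζ p) (hψ : ∀ z, ψ z = ζ ^ (Algebra.trace (ZMod p) F z).val) :
    ∃ v : O, r v = 1 ∧ gaussSum χ⁻¹ ψ = -((ζ - 1) * v) := by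
  have hne : χ⁻¹ ≠ 1 := by
    simpa using teichmuller_pow_ne_one hχ one_pos (by omega)
  refine ⟨-∑ z : F, χ⁻¹ z * ∑ i ∈ Finset.range (Algebra.trace (ZMod p) F z).val, ζ ^ i, ?_, ?_⟩
  · rw [map_neg, neg_eq_iff_eq_neg, ← sum_inv_mul_trace_eq_neg_one p hF, map_sum]
    refine Finset.sum_congr rfl fun z _ => ?_
    rw [map_mul, MulChar.inv_apply', hχ]
    simp only [map_sum, map_pow, map_eq_one_of_isPrimitiveRoot r hζ, one_pow,
      Finset.sum_const, Finset.card_range, nsmul_eq_mul, mul_one]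
    congr 1
    conv_rhs => rw [← ZMod.natCast_zmod_val (Algebra.trace (ZMod p) F z)]
    rw [map_natCast]
  · rw [mul_neg, neg_neg, Finset.mul_sum, gaussSum, ← sub_zero (∑ a, _),
      ← MulChar.sum_eq_zero_of_ne_one hne, ← Finset.sum_sub_distrib]
    refine Finset.sum_congr rfl fun z _ => ?_
    rw [hψ, mul_left_comm, mul_geom_sum]
    ring

/-- Stickelberger's congruence for the Gauss sum of a power of the inverse Teichmüller
character, in a form without denominators. -/
theorem exists_mul_gaussSum_teichmuller_pow_inv_eq {r : O →+* F} {χ : MulChar F O}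
    (hχ : ∀ t, r (χ t) = t) (hF : 2 < Fintype.card F) {ψ : AddChar F O} {ζ : O}
    (hζ : IsPrimitiveRoot ζ p) (hψ : ∀ z, ψ z = ζ ^ (Algebra.trace (ZMod p) F z).val)
    (a : ℕ) (ha : a < Fintype.card F - 1) :
    ∃ u v : O, r u = (digitFacProd p a : F) ∧ r v = 1 ∧
      u * gaussSum (χ ^ a)⁻¹ ψ = -((ζ - 1) ^ digitSum p a * v) := by
  have hp := (Fact.out : p.Prime)
  have : CharP F p := charP_of_injective_algebraMap (algebraMap (ZMod p) F).injective p
  obtain ⟨v₁, hv₁, hG₁⟩ := exists_gaussSum_teichmuller_inv_eq hχ hF hζ hψ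
  induction a using Nat.strong_induction_on with
  | _ a ih =>
    rcases Nat.eq_zero_or_pos a with rfl | ha0
    · have hψ1 : ψ ≠ 1 := by
        intro h
        have hz : gaussSum χ⁻¹ (1 : AddChar F O) = 0 :=
          gaussSum_one_right (by simpa using teichmuller_pow_ne_one hχ one_pos (by omega))
        rw [h, hz, eq_comm, neg_eq_zero, mul_eq_zero] at hG₁
        rcases hG₁ with h0 | h0
        · exact hζ.ne_one hp.one_lt (sub_eq_zero.1 h0)
        · simp [h0] at hv₁
      refine ⟨1, 1, by simp [digitFacProd_zero], map_one r, ?_⟩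
      rw [pow_zero, inv_one, gaussSum_one_left hψ1, digitSum_zero]
      simp
    · obtain ⟨c, hc⟩ : ∃ c, a % p = c := ⟨_, rfl⟩
      rcases c with _ | c
      · have hdvd : a = a / p * p := (Nat.div_mul_cancel (Nat.dvd_of_mod_eq_zero hc)).symm
        have hlt : a / p < a := Nat.div_lt_self ha0 hp.one_lt
        obtain ⟨u, v, hu, hv, h⟩ := ih (a / p) hlt (hlt.trans ha)
        refine ⟨u, v, ?_, hv, ?_⟩
        · rw [hu, digitFacProd_eq_mod_mul p hp.one_lt a, hc]
          simp
        · rw [digitSum_eq_mod_add p hp.one_lt a, hc, zero_add, ← h]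
          congr 1
          rw [← gaussSum_pow_prime ((χ ^ (a / p))⁻¹) hψ, inv_pow, ← pow_mul, ← hdvd]
      · obtain ⟨k, rfl⟩ : ∃ k, a = k + 1 := ⟨a - 1, by omega⟩
        obtain ⟨u, v, hu, hv, h⟩ := ih k (by omega) (by omega)
        have hkm : k % p = c := by
          have hlt : c + 1 < p := hc ▸ Nat.mod_lt _ hp.pos
          have hd := Nat.mod_add_div (k + 1) p
          rw [hc] at hd
          have : k = c + p * ((k + 1) / p) := by omega
          rw [this, Nat.add_mul_mod_self_left, Nat.mod_eq_of_lt (by omega)]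
        have hkd : (k + 1) / p = k / p := by
          have h1 := Nat.mod_add_div (k + 1) p
          have h2 := Nat.mod_add_div k p
          rw [hc] at h1
          rw [hkm] at h2
          exact Nat.eq_of_mul_eq_mul_left hp.pos (by omega)
        have hS : digitSum p (k + 1) = digitSum p k + 1 := by
          rw [digitSum_eq_mod_add p hp.one_lt (k + 1), digitSum_eq_mod_add p hp.one_lt k, hc, hkm,
            hkd]
          ring
        have ht : digitFacProd p (k + 1) = (c + 1) * digitFacProd p k := by
          rw [digitFacProd_eq_mod_mul p hp.one_lt (k + 1), digitFacProd_eq_mod_mul p hp.one_lt k,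
            hc, hkm, hkd, Nat.factorial_succ]
          ring
        have hcast : ((k : F) + 1) = (c : F) + 1 := by
          have : ((k + 1 : ℕ) : F) = ((c + 1 : ℕ) : F) := by
            rw [← hc, CharP.cast_eq_mod F p (k + 1)]
          exact_mod_cast this
        have hmul : (χ ^ k)⁻¹ * χ⁻¹ = (χ ^ (k + 1))⁻¹ := by
          rw [pow_succ, mul_inv]
        have hJ := jacobiSum_mul_nontrivial (χ := (χ ^ k)⁻¹) (φ := χ⁻¹)
          (by rw [hmul]; exact inv_ne_one.2 (teichmuller_pow_ne_one hχ ha0 ha)) ψ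
        refine ⟨-jacobiSum (χ ^ k)⁻¹ χ⁻¹ * u, v * v₁, ?_, by rw [map_mul, hv, hv₁, mul_one], ?_⟩
        · rw [map_mul, map_neg, map_jacobiSum_teichmuller hχ hF (by omega), hu, ht, hcast]
          push_cast
          ring
        · rw [hmul, hG₁] at hJ
          rw [hS, pow_succ (ζ - 1)]
          linear_combination (-u) * hJ + (ζ - 1) * v₁ * h

theorem digitFacProd_congr_of_gaussSum_eq {r : O →+* F} {χ : MulChar F O}
    (hχ : ∀ t, r (χ t) = t) (hF : 2 < Fintype.card F) (hodd : Odd p) {ψ : AddChar F O} {ζ : O}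
    (hζ : IsPrimitiveRoot ζ p) (hψ : ∀ z, ψ z = ζ ^ (Algebra.trace (ZMod p) F z).val)
    {a : ℕ} (ha : a < Fintype.card F - 1) {x : ℕ} {c w : O}
    (h : c * gaussSum (χ ^ a)⁻¹ ψ = (p : O) ^ x * w) :
    (digitSum p a = (p - 1) * x → (digitFacProd p a : F) * r w = (-1) ^ (x + 1) * r c) ∧
      ((p - 1) * x < digitSum p a → r w = 0) := by
  have hp := (Fact.out : p.Prime)
  have : CharP F p := charP_of_injective_algebraMap (algebraMap (ZMod p) F).injective p
  obtain ⟨u, v, hu, hv, hG⟩ := exists_mul_gaussSum_teichmuller_pow_inv_eq hχ hF hζ hψ a ha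
  obtain ⟨e, he, hpe⟩ := exists_prime_eq_sub_one_pow_mul r hodd hζ
  have hπ : ζ - 1 ≠ 0 := sub_ne_zero.2 (hζ.ne_one hp.one_lt)
  have hkey : (ζ - 1) ^ digitSum p a * (-(c * v)) = (ζ - 1) ^ ((p - 1) * x) * (u * e ^ x * w) := by
    rw [pow_mul]
    rw [hpe, mul_pow] at h
    linear_combination u * h - c * hG
  constructor
  · intro hS
    rw [hS] at hkey
    have := congrArg r (mul_left_cancel₀ (pow_ne_zero _ hπ) hkey)
    simp only [map_neg, map_mul, map_pow, hv, hu, he, mul_one] at this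
    have hsq : ((-1 : F) ^ x) * (-1) ^ x = 1 := by rw [← mul_pow]; simp
    rw [pow_succ]
    linear_combination (-(-1) ^ x) * this - (digitFacProd p a : F) * r w * hsq
  · intro hS
    obtain ⟨d, hd⟩ := Nat.exists_eq_add_of_lt hS
    rw [hd, add_assoc, pow_add, mul_assoc] at hkey
    have := congrArg r (mul_left_cancel₀ (pow_ne_zero _ hπ) hkey)
    simp only [map_neg, map_mul, map_pow, hv, hu, he, map_sub, map_one,
      map_eq_one_of_isPrimitiveRoot r hζ, sub_self, ne_eq, Nat.succ_ne_zero, not_false_eq_true,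
      zero_pow, zero_mul] at this
    have ht : (digitFacProd p a : F) ≠ 0 := by
      rw [Ne, CharP.cast_eq_zero_iff F p]
      exact (Nat.Prime.coprime_iff_not_dvd hp).1 (coprime_digitFacProd hp a)
    rcases mul_eq_zero.1 this.symm with h0 | h0
    · exact absurd h0 (mul_ne_zero ht (pow_ne_zero _ (by simp)))
    · exact h0

end Stickelberger

section TeichmullerLift

variable {F O : Type*} [Field F] [Fintype F] [CommRing O]

theorem MulChar.pow_card_sub_one_eq_one (χ : MulChar F O) : χ ^ (Fintype.card F - 1) = 1 := by
  classical
  rw [← Fintype.card_units]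
  exact χ.pow_card_eq_one

variable [IsDomain O]

theorem eq_of_pow_card_sub_one_eq_one {r : O →+* F} {ω : F → O}
    (hω : ∀ t, t ≠ 0 → ω t ^ (Fintype.card F - 1) = 1) (hr : ∀ t, r (ω t) = t)
    {α β : O} (hα : α ^ (Fintype.card F - 1) = 1) (hβ : β ^ (Fintype.card F - 1) = 1)
    (h : r α = r β) : α = β := by
  classical
  have hpos : 0 < Fintype.card F - 1 := Nat.sub_pos_of_lt Fintype.one_lt_card
  have hinj : Function.Injective ω := Function.LeftInverse.injective hr
  have hsub : (Finset.univ.erase (0 : F)).image ω ⊆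
      Polynomial.nthRootsFinset (Fintype.card F - 1) (1 : O) := by
    intro z hz
    obtain ⟨t, ht, rfl⟩ := Finset.mem_image.1 hz
    exact (Polynomial.mem_nthRootsFinset hpos _).2 (hω t (Finset.ne_of_mem_erase ht))
  have heq := Finset.eq_of_subset_of_card_le hsub (by
    rw [Finset.card_image_of_injective _ hinj, Finset.card_erase_of_mem (Finset.mem_univ _),
      Finset.card_univ, Polynomial.nthRootsFinset]
    exact (Multiset.toFinset_card_le _).trans (Polynomial.card_nthRoots _ _))
  have hmem : ∀ γ : O, γ ^ (Fintype.card F - 1) = 1 → ω (r γ) = γ := by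
    intro γ hγ
    have := (Polynomial.mem_nthRootsFinset hpos (1 : O)).2 hγ
    rw [← heq] at this
    obtain ⟨t, _, rfl⟩ := Finset.mem_image.1 this
    rw [hr]
  rw [← hmem α hα, ← hmem β hβ, h]

theorem exists_mulChar_eq_of_lift {r : O →+* F} {ω : F → O} (hω0 : ω 0 = 0)
    (hω : ∀ t, t ≠ 0 → ω t ^ (Fintype.card F - 1) = 1) (hr : ∀ t, r (ω t) = t) :
    ∃ χ : MulChar F O, ∀ t, χ t = ω t := by
  refine ⟨{ toFun := ω, map_one' := ?_, map_mul' := ?_, map_nonunit' := ?_ }, fun _ => rfl⟩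
  · exact eq_of_pow_card_sub_one_eq_one hω hr (hω 1 one_ne_zero) (one_pow _)
      (by rw [hr, map_one])
  · intro x y
    by_cases hx : x = 0
    · simp [hx, hω0]
    by_cases hy : y = 0
    · simp [hy, hω0]
    exact eq_of_pow_card_sub_one_eq_one hω hr (hω _ (mul_ne_zero hx hy))
      (by rw [mul_pow, hω x hx, hω y hy, one_mul]) (by rw [map_mul, hr, hr, hr])
  · intro t ht
    rw [isUnit_iff_ne_zero, not_not] at ht
    exact ht ▸ hω0

end TeichmullerLift

section Conjugation

open ComplexConjugate

theorem Complex.conj_eq_neg_of_sq_eq_neg_natCast {z : ℂ} {L : ℕ} (h : z ^ 2 = -(L : ℂ)) :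
    conj z = -z := by
  have hre := congrArg Complex.re h
  have him := congrArg Complex.im h
  simp only [pow_two, Complex.mul_re, Complex.mul_im, Complex.neg_re, Complex.neg_im,
    Complex.natCast_re, Complex.natCast_im] at hre him
  have hz : z.re = 0 := by
    rcases mul_eq_zero.1 (show z.re * z.im = 0 by linarith) with h0 | h0
    · exact h0
    · rw [h0] at hre
      have : (0 : ℝ) ≤ L := Nat.cast_nonneg L
      exact pow_eq_zero_iff two_ne_zero |>.1 (by nlinarith [sq_nonneg z.re])
  apply Complex.ext <;> simp [hz]

theorem Complex.mul_conj_eq_one_of_pow_eq_one {z : ℂ} {m : ℕ} (hm : m ≠ 0) (h : z ^ m = 1) :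
    z * conj z = 1 := by
  rw [Complex.mul_conj, Complex.normSq_eq_norm_sq, Complex.norm_eq_one_of_pow_eq_one h hm]
  simp

variable {F O : Type*} [Field F] [Fintype F] [CommRing O]

theorem conj_map_gaussSum (φ : O →+* ℂ) {p : ℕ} [Fact p.Prime] [Algebra (ZMod p) F]
    (χ : MulChar F O) {ψ : AddChar F O} :
    conj (φ (gaussSum χ ψ)) = φ (χ (-1) * gaussSum χ⁻¹ ψ) := by
  have hp := (Fact.out : p.Prime)
  have : CharP F p := charP_of_injective_algebraMap (algebraMap (ZMod p) F).injective p
  have hmul : ∀ z, conj (φ (χ z)) = φ (χ⁻¹ z) := by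
    intro z
    by_cases hz : z = 0
    · simp [hz, MulChar.map_zero]
    have h1 : φ (χ z) * φ (χ⁻¹ z) = 1 := by
      rw [MulChar.inv_apply', ← map_mul, ← map_mul, mul_inv_cancel₀ hz, map_one, map_one]
    have h2 : φ (χ z) * conj (φ (χ z)) = 1 := by
      refine Complex.mul_conj_eq_one_of_pow_eq_one
        (Nat.sub_pos_of_lt (Fintype.one_lt_card (α := F))).ne' ?_
      rw [← map_pow, ← map_pow, FiniteField.pow_card_sub_one_eq_one z hz, map_one, map_one]
    exact mul_left_cancel₀ (left_ne_zero_of_mul_eq_one h1) (h2.trans h1.symm)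
  have hadd : ∀ z, conj (φ (ψ z)) = φ (ψ (-z)) := by
    intro z
    have h1 : φ (ψ z) * φ (ψ (-z)) = 1 := by
      rw [← map_mul, ← AddChar.map_add_eq_mul, add_neg_cancel, AddChar.map_zero_eq_one, map_one]
    have h2 : φ (ψ z) * conj (φ (ψ z)) = 1 := by
      refine Complex.mul_conj_eq_one_of_pow_eq_one hp.ne_zero ?_
      rw [← map_pow, ← AddChar.map_nsmul_eq_pow, nsmul_eq_mul, CharP.cast_eq_zero, zero_mul,
        AddChar.map_zero_eq_one, map_one]
    exact mul_left_cancel₀ (left_ne_zero_of_mul_eq_one h1) (h2.trans h1.symm)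
  have hneg : χ (-1) = χ⁻¹ (-1) := by
    rw [MulChar.inv_apply', inv_neg, inv_one]
  rw [gaussSum, gaussSum, hneg, Finset.mul_sum, map_sum, map_sum, map_sum]
  refine Fintype.sum_equiv (Equiv.neg F) _ _ fun z => ?_
  rw [map_mul, map_mul, hmul, hadd, ← map_mul, Equiv.neg_apply, ← mul_assoc, ← map_mul χ⁻¹]
  simp

theorem gaussSum_conj_relation {φ : O →+* ℂ} (hφ : Function.Injective φ) {p : ℕ} [Fact p.Prime]
    [Algebra (ZMod p) F] {χ : MulChar F O} {ψ : AddChar F O} {L : ℕ} {s : O}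
    (hs : s ^ 2 = -(L : O)) {a b : ℤ} {x y : ℕ}
    (hG : 2 ^ y * gaussSum χ ψ = (p : O) ^ x * (a + b * s)) :
    2 ^ y * χ (-1) * gaussSum χ⁻¹ ψ = (p : O) ^ x * (a - b * s) := by
  have hs' : conj (φ s) = -φ s :=
    Complex.conj_eq_neg_of_sq_eq_neg_natCast (L := L) (by rw [← map_pow, hs]; simp)
  have h := congrArg (fun z => conj (φ z)) hG
  apply hφ
  simp only [map_mul φ (2 ^ y), map_mul conj, conj_map_gaussSum φ (p := p) χ] at h
  simp only [map_mul, map_pow, map_add, map_sub, map_natCast, map_intCast, map_ofNat, hs'] at h ⊢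
  linear_combination h

end Conjugation

theorem digitFacProd_congr_of_lift {F O : Type*} [Field F] [Fintype F] [DecidableEq F]
    [CommRing O] [IsDomain O] {p : ℕ} [Fact p.Prime] [Algebra (ZMod p) F] (hodd : Odd p)
    {φ : O →+* ℂ} (hφ : Function.Injective φ) {r : O →+* F} {ω : F → O} (hω0 : ω 0 = 0)
    (hω : ∀ t, t ≠ 0 → ω t ^ (Fintype.card F - 1) = 1) (hr : ∀ t, r (ω t) = t)
    (hF : 2 < Fintype.card F) {n : ℕ} (hn0 : 0 < n) (hn : n < Fintype.card F - 1)
    {ζ : O} (hζ : IsPrimitiveRoot ζ p) {L : ℕ} {s : O} (hs : s ^ 2 = -(L : O))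
    {a b : ℤ} {x y : ℕ}
    (hG : 2 ^ y * (∑ z ∈ Finset.univ.erase (0 : F),
        ω z ^ n * ζ ^ (Algebra.trace (ZMod p) F z).val) = (p : O) ^ x * (a + b * s)) :
    ((digitSum p (Fintype.card F - 1 - n) = (p - 1) * x →
        (digitFacProd p (Fintype.card F - 1 - n) : F) * r (a + b * s) =
          (-1) ^ (x + 1) * r (2 ^ y)) ∧
      ((p - 1) * x < digitSum p (Fintype.card F - 1 - n) → r (a + b * s) = 0)) ∧
    ((digitSum p n = (p - 1) * x →
        (digitFacProd p n : F) * r (a - b * s) =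
          (-1) ^ (x + 1) * r (2 ^ y * ω (-1) ^ n)) ∧
      ((p - 1) * x < digitSum p n → r (a - b * s) = 0)) := by
  obtain ⟨χ, hχ⟩ := exists_mulChar_eq_of_lift hω0 hω hr
  have hχr : ∀ t, r (χ t) = t := fun t => by rw [hχ, hr]
  let ψ : AddChar F O := (AddChar.zmodChar p hζ.pow_eq_one).compAddMonoidHom
    (Algebra.trace (ZMod p) F).toAddMonoidHom
  have hψ : ∀ z, ψ z = ζ ^ (Algebra.trace (ZMod p) F z).val := fun z => rfl
  have hsum : ∑ z ∈ Finset.univ.erase (0 : F), ω z ^ n * ζ ^ (Algebra.trace (ZMod p) F z).val =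
      gaussSum (χ ^ n) ψ := by
    rw [gaussSum, ← Finset.add_sum_erase _ _ (Finset.mem_univ (0 : F)), MulChar.map_zero, zero_mul,
      zero_add]
    exact Finset.sum_congr rfl fun z _ => by rw [hψ, MulChar.pow_apply' χ hn0.ne', hχ]
  rw [hsum] at hG
  have hinv : χ ^ n = (χ ^ (Fintype.card F - 1 - n))⁻¹ := by
    rw [eq_inv_iff_mul_eq_one, ← pow_add, Nat.add_sub_cancel' hn.le,
      MulChar.pow_card_sub_one_eq_one]
  have hG' := gaussSum_conj_relation hφ (p := p) hs hG
  rw [MulChar.pow_apply' χ hn0.ne', hχ] at hG'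
  refine ⟨digitFacProd_congr_of_gaussSum_eq hχr hF hodd hζ hψ (by omega) ?_,
    digitFacProd_congr_of_gaussSum_eq hχr hF hodd hζ hψ hn hG'⟩
  rw [← hinv, hG]

/-- **Sign determination in the index 2 case, form (3): `G(χ) = 2^{−y} p^x (a + b√−L)`.**
Let `p` be an odd prime, `N ≥ 2` with `gcd(N,p) = 1`, `f` the order of `p` mod `N`,
`q = p^f`, `n = (q−1)/N`.  Assume `[(ℤ/Nℤ)^* : ⟨p⟩] = 2` (i.e. `2f = φ(N)`) and
`−1 ∉ ⟨p⟩`, so that the decomposition field of `p` in `ℚ(ζ_N)` is the imaginary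
quadratic field `ℚ(√−L)`, `L` squarefree positive.  Let `E = ℚ(ζ_{q−1}, ζ_p)`, `𝔓` the
prime of `𝓞 E` above `p` with residue field `F_q`, `ω` the Teichmüller map, `χ = ω^n`,
`G(χ) = ∑_{z ≠ 0} ω(z)^n ζp^{T(z)}` the Gauss sum, and `s = √−L ∈ ℚ(ζ_N)`.
If `2^y·G(χ) = p^x·(a + b·s)` then:
(i) if `S(−n) = (p−1)x` then `t(−n)·(a + b√−L) ≡ (−1)^(x+1)·2^y (mod 𝔓)`, while if
`S(−n) > (p−1)x` then `a + b√−L ≡ 0 (mod 𝔓)`;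
(ii) if `S(n) = (p−1)x` then `t(n)·(a − b√−L) ≡ (−1)^(x+1)·χ(−1)·2^y (mod 𝔓)`, with
`χ(−1) = ω(−1)^n`, while if `S(n) > (p−1)x` then `a − b√−L ≡ 0 (mod 𝔓)`.
(Here `−n ≡ q−1−n (mod q−1)`.) -/
theorem sign_determination_index_two_form_three
    (p N f q n : ℕ) (hp : p.Prime) (hodd : Odd p)
    (hN : 2 ≤ N) (hNp : Nat.Coprime N p)
    (hf : orderOf (p : ZMod N) = f) (hq : q = p ^ f) (hn : n = (q - 1) / N)
    (hindex : 2 * f = Nat.totient N)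
    (hneg : ∀ k : ℕ, (p : ZMod N) ^ k ≠ -1)
    (E : Type) [Field E] [NumberField E]
    (ζ ζp : 𝓞 E)
    (hζ : IsPrimitiveRoot ζ (q - 1)) (hζp : IsPrimitiveRoot ζp p)
    (hgen : Algebra.adjoin ℚ {(ζ : E), (ζp : E)} = ⊤)
    (𝔓 : Ideal (𝓞 E)) (hprime : 𝔓.IsPrime) (hp𝔓 : (p : 𝓞 E) ∈ 𝔓)
    [Fintype (𝓞 E ⧸ 𝔓)] [DecidableEq (𝓞 E ⧸ 𝔓)]
    (hcard : Fintype.card (𝓞 E ⧸ 𝔓) = q)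
    [Algebra (ZMod p) (𝓞 E ⧸ 𝔓)]
    (ω : (𝓞 E ⧸ 𝔓) → 𝓞 E)
    (hω0 : ω 0 = 0)
    (hωroot : ∀ t : 𝓞 E ⧸ 𝔓, t ≠ 0 → ω t ^ (q - 1) = 1)
    (hωlift : ∀ t : 𝓞 E ⧸ 𝔓, Ideal.Quotient.mk 𝔓 (ω t) = t)
    (L : ℕ) (hL : 0 < L) (hLsf : Squarefree L)
    (s : 𝓞 E) (hs : s ^ 2 = -(L : 𝓞 E))
    (hsmem : (s : E) ∈ Algebra.adjoin ℚ {((ζ : E)) ^ n})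
    (a b : ℤ) (x y : ℕ)
    (hG : (2 : 𝓞 E) ^ y *
        (∑ z ∈ Finset.univ.filter (fun z : 𝓞 E ⧸ 𝔓 => z ≠ 0),
          ω z ^ n * ζp ^ (Algebra.trace (ZMod p) (𝓞 E ⧸ 𝔓) z).val)
      = (p : 𝓞 E) ^ x * ((a : 𝓞 E) + (b : 𝓞 E) * s)) :
    ((digitSum p (q - 1 - n) = (p - 1) * x →
        (digitFacProd p (q - 1 - n) : 𝓞 E) * ((a : 𝓞 E) + (b : 𝓞 E) * s) -
          (-1) ^ (x + 1) * 2 ^ y ∈ 𝔓) ∧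
      ((p - 1) * x < digitSum p (q - 1 - n) →
        (a : 𝓞 E) + (b : 𝓞 E) * s ∈ 𝔓)) ∧
    ((digitSum p n = (p - 1) * x →
        (digitFacProd p n : 𝓞 E) * ((a : 𝓞 E) - (b : 𝓞 E) * s) -
          (-1) ^ (x + 1) * ω (Ideal.Quotient.mk 𝔓 (-1)) ^ n * 2 ^ y ∈ 𝔓) ∧
      ((p - 1) * x < digitSum p n →
        (a : 𝓞 E) - (b : 𝓞 E) * s ∈ 𝔓)) := by
  have : Fact p.Prime := ⟨hp⟩
  have hmax : 𝔓.IsMaximal := Ideal.Quotient.maximal_of_isField 𝔓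
    (Finite.isField_of_domain (𝓞 E ⧸ 𝔓))
  let _ : Field (𝓞 E ⧸ 𝔓) := Ideal.Quotient.field 𝔓
  have hNdvd : N ∣ q - 1 := by
    rw [← CharP.cast_eq_zero_iff (ZMod N) N, Nat.cast_sub (hq ▸ Nat.one_le_pow _ _ hp.pos), hq,
      Nat.cast_pow, ← hf, pow_orderOf_eq_one]
    simp
  have hq2 : 2 < q := by
    have hq1 : 1 < q := hcard ▸ Fintype.one_lt_card
    have hqodd : Odd q := hq ▸ hodd.pow
    obtain ⟨k, hk⟩ := hqodd
    omega
  have hn0 : 0 < n := hn ▸ Nat.div_pos (Nat.le_of_dvd (by omega) hNdvd) (by omega)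
  have hnlt : n < q - 1 := hn ▸ Nat.div_lt_self (by omega) (by omega)
  obtain ⟨φ⟩ : Nonempty (E →+* ℂ) := inferInstance
  have hφ : Function.Injective (φ.comp (algebraMap (𝓞 E) E)) :=
    φ.injective.comp RingOfIntegers.coe_injective
  have hmem : ∀ z : 𝓞 E, z ∈ 𝔓 ↔ Ideal.Quotient.mk 𝔓 z = 0 := fun z =>
    Ideal.Quotient.eq_zero_iff_mem.symm
  have key := digitFacProd_congr_of_lift hodd hφ (r := Ideal.Quotient.mk 𝔓) hω0
    (by rwa [hcard]) hωlift (by rwa [hcard]) hn0 (by rwa [hcard]) hζp hs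
    (by rw [← hG, Finset.filter_ne'])
  rw [hcard] at key
  simp only [hmem, map_sub, map_mul, map_add, map_pow, map_neg, map_one, map_natCast, hωlift,
    map_ofNat, sub_eq_zero] at key ⊢
  simpa only [mul_assoc, mul_comm ((2 : 𝓞 E ⧸ 𝔓) ^ y)] using key
end
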